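/- arXiv:1810.11098 — 2 statements merged into one kernel-verified Lean document; each statement's English description precedes it below -/
import Mathlib

section
/- Let A ∈ ℝ^{m×m} be a symmetric matrix with nonnegative entries and M ∈ ℝ^{p×p} a symmetric positive semidefinite matrix such that ‖A‖₂ · ‖M‖₂ < 1. Then I − A ⊗ M is positive definite and ‖(I − A ⊗ M)^{−1}‖₂ = 1/(1 − ‖A‖₂ · ‖M‖₂). -/
open Matrix Real
open scoped BigOperators Kronecker

noncomputable def specNorm {ι κ : Type*} [Fintype ι] [Fintype κ] [DecidableEq κ]
    (M : Matrix ι κ ℝ) : ℝ :=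
  ‖LinearMap.toContinuousLinearMap (Matrix.toEuclideanLin M)‖


lemma le_of_sq_le_sq' {a b : ℝ} (h : a ^ 2 ≤ b ^ 2) (hb : 0 ≤ b) : a ≤ b :=
  (le_abs_self a).trans (abs_le_of_sq_le_sq h hb)

lemma sn_nonneg {ι : Type*} [Fintype ι] [DecidableEq ι] (A : Matrix ι ι ℝ) : 0 ≤ specNorm A :=
  norm_nonneg _

lemma sn_norm_sq {ι : Type*} [Fintype ι] (x : EuclideanSpace ℝ ι) :
    ‖x‖ ^ 2 = x.ofLp ⬝ᵥ x.ofLp := by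
  rw [EuclideanSpace.real_norm_sq_eq]
  simp [dotProduct, sq]

lemma sn_bound {ι : Type*} [Fintype ι] [DecidableEq ι] (A : Matrix ι ι ℝ) (x : ι → ℝ) :
    (A *ᵥ x) ⬝ᵥ (A *ᵥ x) ≤ specNorm A ^ 2 * (x ⬝ᵥ x) := by
  have h := (LinearMap.toContinuousLinearMap (Matrix.toEuclideanLin A)).le_opNorm (WithLp.toLp 2 x)
  have h2 := pow_le_pow_left₀ (norm_nonneg _) h 2
  rw [mul_pow, sn_norm_sq, sn_norm_sq] at h2
  simpa [specNorm] using h2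

lemma sn_le {ι : Type*} [Fintype ι] [DecidableEq ι] (A : Matrix ι ι ℝ) (c : ℝ) (hc : 0 ≤ c)
    (h : ∀ x : ι → ℝ, (A *ᵥ x) ⬝ᵥ (A *ᵥ x) ≤ c ^ 2 * (x ⬝ᵥ x)) : specNorm A ≤ c := by
  refine ContinuousLinearMap.opNorm_le_bound _ hc fun x => ?_
  refine le_of_sq_le_sq' ?_ (by positivity)
  rw [mul_pow, sn_norm_sq, sn_norm_sq]
  simpa using h x.ofLp

lemma sn_attain {ι : Type*} [Fintype ι] [DecidableEq ι] [Nonempty ι] (A : Matrix ι ι ℝ) :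
    ∃ v : ι → ℝ, v ⬝ᵥ v = 1 ∧ (A *ᵥ v) ⬝ᵥ (A *ᵥ v) = specNorm A ^ 2 := by
  obtain ⟨v, hv, hmax⟩ := (isCompact_sphere (0 : EuclideanSpace ℝ ι) 1).exists_isMaxOn
    (NormedSpace.sphere_nonempty.2 zero_le_one)
    (f := fun x => ‖LinearMap.toContinuousLinearMap (Matrix.toEuclideanLin A) x‖) (by fun_prop)
  have hv1 : ‖v‖ = 1 := by simpa using hv
  have hv2 : v.ofLp ⬝ᵥ v.ofLp = 1 := by rw [← sn_norm_sq, hv1]; norm_num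
  refine ⟨v.ofLp, hv2, ?_⟩
  apply le_antisymm
  · simpa [hv2] using sn_bound A v.ofLp
  · have : specNorm A ≤ ‖LinearMap.toContinuousLinearMap (Matrix.toEuclideanLin A) v‖ := by
      refine ContinuousLinearMap.opNorm_le_of_unit_norm (norm_nonneg _) fun x hx => ?_
      exact hmax (by simpa using hx)
    have h2 := pow_le_pow_left₀ (sn_nonneg A) this 2
    rw [sn_norm_sq] at h2
    simpa using h2

lemma dp_nonneg {ι : Type*} [Fintype ι] (x : ι → ℝ) : 0 ≤ x ⬝ᵥ x :=
  Finset.sum_nonneg fun i _ => mul_self_nonneg _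

lemma symm_dp {ι : Type*} [Fintype ι] {A : Matrix ι ι ℝ} (hA : A.IsSymm) (x y : ι → ℝ) :
    (A *ᵥ x) ⬝ᵥ y = x ⬝ᵥ (A *ᵥ y) := by
  rw [dotProduct_mulVec, ← mulVec_transpose, hA.eq]

lemma eig_of_attain {ι : Type*} [Fintype ι] [DecidableEq ι] (A : Matrix ι ι ℝ) (hA : A.IsSymm)
    (v : ι → ℝ) (hv : v ⬝ᵥ v = 1) (hv2 : (A *ᵥ v) ⬝ᵥ (A *ᵥ v) = specNorm A ^ 2)
    (hp : 0 ≤ v ⬝ᵥ (A *ᵥ v)) : ∃ w : ι → ℝ, w ≠ 0 ∧ A *ᵥ w = specNorm A • w := by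
  have ha := sn_nonneg A
  set a := specNorm A with hadef
  have key : A *ᵥ (A *ᵥ v) = a ^ 2 • v := by
    rw [← sub_eq_zero, ← dotProduct_self_eq_zero]
    apply le_antisymm _ (dp_nonneg _)
    have h1 := sn_bound A (A *ᵥ v)
    rw [hv2, ← hadef] at h1
    have h2 := symm_dp hA (A *ᵥ v) v
    have h3 := dotProduct_comm v (A *ᵥ (A *ᵥ v))
    simp only [sub_dotProduct, dotProduct_sub, smul_dotProduct, dotProduct_smul, smul_eq_mul]
    rw [h3, h2, hv2, hv]
    nlinarith
  rcases ha.eq_or_lt with h0 | h0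
  · refine ⟨v, ?_, ?_⟩
    · rintro rfl; simp at hv
    · rw [← h0] at hv2 ⊢
      have : A *ᵥ v = 0 := by
        rw [← dotProduct_self_eq_zero, hv2]; norm_num
      simp [this]
  · refine ⟨A *ᵥ v + a • v, ?_, ?_⟩
    · intro h
      have := congrArg (fun z => v ⬝ᵥ z) h
      simp [dotProduct_add, dotProduct_smul, hv] at this
      linarith
    · rw [mulVec_add, mulVec_smul, key, smul_add, smul_smul, add_comm, sq]

lemma eig_nonneg {ι : Type*} [Fintype ι] [DecidableEq ι] [Nonempty ι] (A : Matrix ι ι ℝ)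
    (hA : A.IsSymm) (h : ∀ j k, 0 ≤ A j k) :
    ∃ w : ι → ℝ, w ≠ 0 ∧ A *ᵥ w = specNorm A • w := by
  obtain ⟨v, hv, hv2⟩ := sn_attain A
  have hu : (fun i => |v i|) ⬝ᵥ (fun i => |v i|) = 1 := by
    rw [← hv]; simp [dotProduct]
  refine eig_of_attain A hA (fun i => |v i|) hu ?_ ?_
  · apply le_antisymm
    · simpa [hu] using sn_bound A (fun i => |v i|)
    · rw [← hv2]
      refine Finset.sum_le_sum fun i _ => ?_
      rw [← abs_mul_abs_self ((A *ᵥ v) i)]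
      have : |(A *ᵥ v) i| ≤ (A *ᵥ fun i => |v i|) i := by
        refine (Finset.abs_sum_le_sum_abs _ _).trans (le_of_eq ?_)
        refine Finset.sum_congr rfl fun j _ => ?_
        rw [abs_mul, abs_of_nonneg (h i j)]
      exact mul_self_le_mul_self (abs_nonneg _) this
  · exact Finset.sum_nonneg fun i _ => mul_nonneg (abs_nonneg _)
      (Finset.sum_nonneg fun j _ => mul_nonneg (h i j) (abs_nonneg _))

lemma eig_psd {ι : Type*} [Fintype ι] [DecidableEq ι] [Nonempty ι] (A : Matrix ι ι ℝ)
    (hA : A.PosSemidef) : ∃ w : ι → ℝ, w ≠ 0 ∧ A *ᵥ w = specNorm A • w := by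
  obtain ⟨v, hv, hv2⟩ := sn_attain A
  refine eig_of_attain A (by simpa [IsSymm, IsHermitian] using hA.isHermitian) v hv hv2 ?_
  simpa using hA.dotProduct_mulVec_nonneg v

lemma kron_bound {m p : ℕ} (A : Matrix (Fin m) (Fin m) ℝ) (M : Matrix (Fin p) (Fin p) ℝ)
    (x : Fin m × Fin p → ℝ) :
    ((A ⊗ₖ M) *ᵥ x) ⬝ᵥ ((A ⊗ₖ M) *ᵥ x) ≤ (specNorm A * specNorm M) ^ 2 * (x ⬝ᵥ x) := by
  let y : Fin m → Fin p → ℝ := fun i => M *ᵥ (fun j => x (i, j))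
  have e : ∀ i j, ((A ⊗ₖ M) *ᵥ x) (i, j) = (A *ᵥ (fun k => y k j)) i := by
    intro i j
    simp only [mulVec, dotProduct, Fintype.sum_prod_type, kroneckerMap_apply, y, Finset.mul_sum]
    simp only [mul_assoc]
  have h1 : ((A ⊗ₖ M) *ᵥ x) ⬝ᵥ ((A ⊗ₖ M) *ᵥ x)
      = ∑ j, (A *ᵥ (fun k => y k j)) ⬝ᵥ (A *ᵥ (fun k => y k j)) := by
    rw [dotProduct, Fintype.sum_prod_type, Finset.sum_comm]
    simp only [e]; rfl
  have h2 : ∑ j, (fun k => y k j) ⬝ᵥ (fun k => y k j) = ∑ k, y k ⬝ᵥ y k := by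
    simp only [dotProduct]; rw [Finset.sum_comm]
  have h3 : x ⬝ᵥ x = ∑ k, (fun j => x (k, j)) ⬝ᵥ (fun j => x (k, j)) := by
    simp only [dotProduct]; rw [Fintype.sum_prod_type]
  rw [h1]
  refine (Finset.sum_le_sum fun j _ => sn_bound A _).trans ?_
  rw [← Finset.mul_sum, h2, mul_pow, mul_assoc, h3]
  refine mul_le_mul_of_nonneg_left ?_ (sq_nonneg _)
  rw [Finset.mul_sum]
  exact Finset.sum_le_sum fun k _ => sn_bound M _

lemma dp_cs {ι : Type*} [Fintype ι] (x y : ι → ℝ) : (x ⬝ᵥ y) ^ 2 ≤ (x ⬝ᵥ x) * (y ⬝ᵥ y) := by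
  have := Finset.sum_mul_sq_le_sq_mul_sq Finset.univ x y
  simpa [dotProduct, sq] using this

/-- if `A` is symmetric with nonnegative entries and `M` is symmetric positive
semidefinite with `‖A‖₂ ‖M‖₂ < 1`, then `I − A ⊗ M` is positive definite and
`‖(I − A ⊗ M)⁻¹‖₂ = 1/(1 − ‖A‖₂ ‖M‖₂)`. -/
theorem id_sub_kronecker_inverse_norm
    (m p : ℕ) (hm : 0 < m) (hp : 0 < p)
    (A : Matrix (Fin m) (Fin m) ℝ) (M : Matrix (Fin p) (Fin p) ℝ)
    (hA : A.IsSymm) (hAnonneg : ∀ j k, 0 ≤ A j k) (hM : M.PosSemidef)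
    (h : specNorm A * specNorm M < 1) :
    ((1 : Matrix (Fin m × Fin p) (Fin m × Fin p) ℝ) - A ⊗ₖ M).PosDef ∧
      specNorm ((1 : Matrix (Fin m × Fin p) (Fin m × Fin p) ℝ) - A ⊗ₖ M)⁻¹ =
        1 / (1 - specNorm A * specNorm M) := by
  haveI : Nonempty (Fin m) := ⟨⟨0, hm⟩⟩
  haveI : Nonempty (Fin p) := ⟨⟨0, hp⟩⟩
  obtain ⟨v, hv0, hv⟩ := eig_nonneg A hA hAnonneg
  obtain ⟨w, hw0, hw⟩ := eig_psd M hM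
  have hMs : M.IsSymm := by simpa [IsSymm, IsHermitian] using hM.isHermitian
  have hKb := kron_bound A M
  have hc : 0 ≤ specNorm A * specNorm M := mul_nonneg (sn_nonneg A) (sn_nonneg M)
  have hKz : (A ⊗ₖ M) *ᵥ (fun q : Fin m × Fin p => v q.1 * w q.2)
      = (specNorm A * specNorm M) • (fun q : Fin m × Fin p => v q.1 * w q.2) := by
    ext ⟨i, j⟩
    have h1 := congrFun hv i
    have h2 := congrFun hw j
    simp only [mulVec, dotProduct, Pi.smul_apply, smul_eq_mul] at h1 h2
    simp only [mulVec, dotProduct, Fintype.sum_prod_type, kroneckerMap_apply, Pi.smul_apply,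
      smul_eq_mul]
    calc _ = (∑ k, A i k * v k) * (∑ l, M j l * w l) := by
          rw [Finset.sum_mul_sum]
          refine Finset.sum_congr rfl fun k _ => Finset.sum_congr rfl fun l _ => by ring
      _ = _ := by rw [h1, h2]; ring
  have hz0 : (fun q : Fin m × Fin p => v q.1 * w q.2) ≠ 0 := by
    obtain ⟨i, hi⟩ := Function.ne_iff.1 hv0
    obtain ⟨j, hj⟩ := Function.ne_iff.1 hw0
    exact Function.ne_iff.2 ⟨(i, j), mul_ne_zero hi hj⟩
  have hKsym : (A ⊗ₖ M).IsSymm := by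
    ext ⟨i, j⟩ ⟨k, l⟩
    simp [kroneckerMap_apply, hA.apply, hMs.apply]
  generalize (fun q : Fin m × Fin p => v q.1 * w q.2) = z at hKz hz0
  generalize A ⊗ₖ M = K at *
  generalize specNorm A * specNorm M = c at *
  have hd : 0 < 1 - c := by linarith
  have hlow : ∀ x, (1 - c) * (x ⬝ᵥ x) ≤ x ⬝ᵥ ((1 - K) *ᵥ x) := by
    intro x
    rw [sub_mulVec, one_mulVec, dotProduct_sub]
    have h1 := dp_cs x (K *ᵥ x)
    have h2 := hKb x
    have h3 := dp_nonneg x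
    have : x ⬝ᵥ (K *ᵥ x) ≤ c * (x ⬝ᵥ x) := by
      refine le_of_sq_le_sq' ?_ (by positivity)
      calc _ ≤ _ := h1
        _ ≤ _ := mul_le_mul_of_nonneg_left h2 h3
        _ = _ := by ring
    linarith
  have hpd : (1 - K).PosDef := by
    refine PosDef.of_dotProduct_mulVec_pos ?_ ?_
    · have : Kᵀ = K := hKsym
      simp [IsHermitian, this]
    · intro x hx
      have : 0 < x ⬝ᵥ x := lt_of_le_of_ne (dp_nonneg x)
        (fun h => hx (dotProduct_self_eq_zero.1 h.symm))
      have := hlow x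
      simp only [star_trivial]
      nlinarith [mul_pos hd ‹0 < x ⬝ᵥ x›]
  refine ⟨hpd, ?_⟩
  have hu : IsUnit (1 - K).det := (Matrix.isUnit_iff_isUnit_det _).1 hpd.isUnit
  apply le_antisymm
  · refine sn_le _ _ (by positivity) fun x => ?_
    obtain ⟨y, rfl⟩ : ∃ y, x = (1 - K) *ᵥ y :=
      ⟨(1 - K)⁻¹ *ᵥ x, by rw [mulVec_mulVec, mul_nonsing_inv _ hu, one_mulVec]⟩
    rw [mulVec_mulVec, nonsing_inv_mul _ hu, one_mulVec]
    have h1 := hlow y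
    have h2 := dp_cs y ((1 - K) *ᵥ y)
    have h3 := dp_nonneg y
    have h4 := dp_nonneg ((1 - K) *ᵥ y)
    generalize (1 - K) *ᵥ y = b at *
    rw [div_pow, one_pow, one_div, inv_mul_eq_div, le_div_iff₀ (by positivity)]
    rcases h3.eq_or_lt with h0 | h0
    · rw [← h0]; simpa using h4
    · have := pow_le_pow_left₀ (by positivity) h1 2
      refine le_of_mul_le_mul_left ?_ h0
      calc _ = ((1 - c) * (y ⬝ᵥ y)) ^ 2 := by ring
        _ ≤ _ := this.trans h2
  · have hz : (1 - K)⁻¹ *ᵥ z = (1 / (1 - c)) • z := by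
      have h1 : (1 - K) *ᵥ z = (1 - c) • z := by
        rw [sub_mulVec, one_mulVec, hKz, sub_smul, one_smul]
      have h2 := congrArg (fun t => (1 - K)⁻¹ *ᵥ t) h1
      simp only [mulVec_mulVec, nonsing_inv_mul _ hu, one_mulVec, mulVec_smul] at h2
      generalize (1 - K)⁻¹ *ᵥ z = t at *
      rw [h2, smul_smul, one_div, inv_mul_cancel₀ hd.ne', one_smul]
    have hzz : 0 < z ⬝ᵥ z := lt_of_le_of_ne (dp_nonneg z)
        (fun h => hz0 (dotProduct_self_eq_zero.1 h.symm))
    have hb := sn_bound (1 - K)⁻¹ z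
    rw [hz, smul_dotProduct, dotProduct_smul, smul_smul, smul_eq_mul, ← sq] at hb
    exact le_of_sq_le_sq' (le_of_mul_le_mul_right hb hzz) (sn_nonneg _)
end

section
/- Let X = (x_1,...,x_m) be a random p×m matrix whose column-stacked vector X_col is centered Gaussian with positive definite covariance Σ = (I − A⊗M)^{−1}, where A ∈ ℝ^{m×m} is symmetric with zero diagonal, M ∈ ℝ^{p×p} is symmetric, ⊗ is the Kronecker product, and I − A⊗M ≻ 0. Then for every j, 𝔼[ (x_j − M Σ_{k} A_{jk} x_k) (Σ_{k} A_{jk} x_k)ᵀ ] = 0 ∈ ℝ^{p×p}. -/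
open Matrix MeasureTheory ProbabilityTheory Real
open scoped BigOperators Kronecker

/-- A measure on `ι → ℝ` is centered Gaussian with covariance matrix `S` if every linear
functional pushes it forward to a one-dimensional centered Gaussian with the right variance. -/
def IsCenteredGaussianVec {ι : Type*} [Fintype ι]
    (μ : Measure (ι → ℝ)) (S : Matrix ι ι ℝ) : Prop :=
  IsProbabilityMeasure μ ∧
    ∀ v : ι → ℝ,
      μ.map (fun z => ∑ i, v i * z i) = gaussianReal 0 (Real.toNNReal (v ⬝ᵥ S.mulVec v))

lemma cg_sq {ι : Type*} [Fintype ι] {μ : Measure (ι → ℝ)} {S : Matrix ι ι ℝ}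
    (h : IsCenteredGaussianVec μ S) (hS : S.PosSemidef) (v : ι → ℝ) :
    MemLp (fun z : ι → ℝ => ∑ i, v i * z i) 2 μ ∧
      ∫ z, (∑ i, v i * z i) ^ 2 ∂μ = v ⬝ᵥ S.mulVec v := by
  have hm : Measurable (fun z : ι → ℝ => ∑ i, v i * z i) := by fun_prop
  have hmap := h.2 v
  have hnn : 0 ≤ v ⬝ᵥ S.mulVec v := by simpa using hS.dotProduct_mulVec_nonneg v
  constructor
  · have h2 : MemLp (id : ℝ → ℝ) 2 (μ.map (fun z => ∑ i, v i * z i)) := by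
      rw [hmap]; exact memLp_id_gaussianReal 2
    exact h2.comp_of_map hm.aemeasurable
  · have h3 : ∫ x, x ^ 2 ∂(gaussianReal 0 (Real.toNNReal (v ⬝ᵥ S.mulVec v)))
        = v ⬝ᵥ S.mulVec v := by
      have := variance_id_gaussianReal (μ := 0) (v := Real.toNNReal (v ⬝ᵥ S.mulVec v))
      rw [variance_eq_integral aemeasurable_id] at this
      simpa [hnn] using this
    rw [← h3, ← hmap, integral_map hm.aemeasurable (by fun_prop)]

lemma cg_mul {ι : Type*} [Fintype ι] {μ : Measure (ι → ℝ)} {S : Matrix ι ι ℝ}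
    (h : IsCenteredGaussianVec μ S) (hS : S.PosSemidef) (u w : ι → ℝ) :
    ∫ z, (∑ i, u i * z i) * (∑ i, w i * z i) ∂μ = u ⬝ᵥ S.mulVec w := by
  obtain ⟨m1, e1⟩ := cg_sq h hS u
  obtain ⟨m2, e2⟩ := cg_sq h hS w
  obtain ⟨m3, e3⟩ := cg_sq h hS (u + w)
  have hi : Integrable (fun z : ι → ℝ => (∑ i, u i * z i) * (∑ i, w i * z i)) μ :=
    m1.integrable_mul m2
  have hi2 : Integrable (fun z : ι → ℝ => (∑ i, u i * z i) ^ 2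
      + 2 * ((∑ i, u i * z i) * (∑ i, w i * z i))) μ :=
    m1.integrable_sq.add (hi.const_mul 2)
  have hs : w ⬝ᵥ S.mulVec u = u ⬝ᵥ S.mulVec w := by
    have ht : Sᵀ = S := by simpa [Matrix.IsHermitian, conjTranspose_eq_transpose_of_trivial] using hS.1
    rw [dotProduct_comm, dotProduct_mulVec, ← mulVec_transpose, ht]
  have hx : ∀ z : ι → ℝ, (∑ i, (u + w) i * z i) ^ 2 = (∑ i, u i * z i) ^ 2
      + 2 * ((∑ i, u i * z i) * (∑ i, w i * z i)) + (∑ i, w i * z i) ^ 2 := by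
    intro z
    simp only [Pi.add_apply, add_mul, Finset.sum_add_distrib]
    ring
  simp_rw [hx] at e3
  rw [integral_add hi2 m2.integrable_sq,
    integral_add m1.integrable_sq (hi.const_mul 2), integral_const_mul, e1, e2,
    mulVec_add, add_dotProduct, dotProduct_add, dotProduct_add, hs] at e3
  linarith

/-- in the Gaussian embedding model with identity conditional covariances, i.e.
`X_col ~ N(0, (I − A⊗M)⁻¹)`, the population score vanishes at the truth:
`𝔼[(x_j − M ∑_k A_{jk} x_k)(∑_k A_{jk} x_k)ᵀ] = 0` for every `j`.  The random matrix `X` is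
realized on the canonical space `Ω = Fin m × Fin p → ℝ` with `x_j(ω) i = ω (j,i)`. -/
theorem population_score_vanishes
    (m p : ℕ)
    (A : Matrix (Fin m) (Fin m) ℝ) (hA : A.IsSymm) (hAdiag : ∀ j, A j j = 0)
    (M : Matrix (Fin p) (Fin p) ℝ) (hM : M.IsSymm)
    (hPD : ((1 : Matrix (Fin m × Fin p) (Fin m × Fin p) ℝ) - A ⊗ₖ M).PosDef)
    (μ : Measure (Fin m × Fin p → ℝ))
    (hGauss : IsCenteredGaussianVec μ
      ((1 : Matrix (Fin m × Fin p) (Fin m × Fin p) ℝ) - A ⊗ₖ M)⁻¹) :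
    ∀ (j : Fin m) (i i' : Fin p),
      ∫ ω, (ω (j, i) - (M.mulVec fun i₂ => ∑ k, A j k * ω (k, i₂)) i) *
          (∑ k, A j k * ω (k, i')) ∂μ = 0 := by
  intro j i i'
  have hQ := hPD.isUnit
  have key := cg_mul hGauss hPD.inv.posSemidef
    (fun q => ((1 : Matrix (Fin m × Fin p) (Fin m × Fin p) ℝ) - A ⊗ₖ M) (j, i) q)
    (fun q => (A ⊗ₖ (1 : Matrix (Fin p) (Fin p) ℝ)) (j, i') q)
  have hdet := (Matrix.isUnit_iff_isUnit_det _).1 hQ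
  have hz : (fun q => ((1 : Matrix (Fin m × Fin p) (Fin m × Fin p) ℝ) - A ⊗ₖ M) (j, i) q) ⬝ᵥ
      ((1 : Matrix (Fin m × Fin p) (Fin m × Fin p) ℝ) - A ⊗ₖ M)⁻¹.mulVec
        (fun q => (A ⊗ₖ (1 : Matrix (Fin p) (Fin p) ℝ)) (j, i') q) = 0 := by
    change (((1 : Matrix (Fin m × Fin p) (Fin m × Fin p) ℝ) - A ⊗ₖ M).mulVec _) (j, i) = 0
    rw [mulVec_mulVec, Matrix.mul_nonsing_inv _ hdet, one_mulVec]
    simp [kroneckerMap_apply, hAdiag]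
  rw [hz] at key
  rw [← key]
  congr 1
  ext ω
  congr 1
  · simp only [Matrix.sub_apply, sub_mul, Finset.sum_sub_distrib, kroneckerMap_apply, one_apply,
      ite_mul, one_mul, zero_mul, Finset.sum_ite_eq, Finset.mem_univ, if_true, mulVec, dotProduct]
    congr 1
    rw [Fintype.sum_prod_type_right]
    refine Finset.sum_congr rfl fun l _ => ?_
    rw [Finset.mul_sum]
    exact Finset.sum_congr rfl fun k _ => by ring
  · rw [Fintype.sum_prod_type]
    simp [kroneckerMap_apply, one_apply]
end
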